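/- arXiv:0807.2077 — 7 statements merged into one kernel-verified Lean document; each statement's English description precedes it below -/
import Mathlib

section
/- Let δ ∈ [0.04, 9] be a real number. For every integer n ≥ 4, the function d ↦ a₂(n,d,δ) is strictly decreasing on the positive integers d. Furthermore, for every integer n ≥ 8 and every positive integer d, a₂(n+1,d,δ) < max(1, a₂(n,d,δ)). -/
open Real Finset

/-- The real value `ζ(x)` of the Riemann zeta function at a real argument. -/
noncomputable def zetaR (x : ℝ) : ℝ := (riemannZeta (x : ℂ)).re

/-- `A(n) = (2π)^n/(n−1)! · ∏_{j=1}^{n−1} (2π)^{2j}/(2j−1)!`. -/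
noncomputable def A (n : ℕ) : ℝ :=
  (2 * π) ^ n / (Nat.factorial (n - 1)) *
    ∏ j ∈ Finset.Icc 1 (n - 1), (2 * π) ^ (2 * j) / (Nat.factorial (2 * j - 1))

/-- The function `a₂(n,d,δ)` from §5.2 of the paper. -/
noncomputable def a₂ (n d : ℕ) (δ : ℝ) : ℝ :=
  ((Real.Gamma ((1 + δ) / 2) * zetaR (1 + δ)) ^ 2 / (π ^ (1 + δ) * Real.exp 0.92)
      * A n * (25 * δ * (1 + δ)) ^ ((2 : ℝ) / d))
    ^ ((2 : ℝ) / (2 * (n : ℝ) ^ 2 - (n : ℝ) - 2 - 2 * δ))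

theorem one_le_zetaR {x : ℝ} (hx : 1 < x) : 1 ≤ zetaR x := by
  have hterm : ∀ n : ℕ, (1 : ℂ) / (n : ℂ) ^ (x : ℂ) = ((1 / (n : ℝ) ^ x : ℝ) : ℂ) := fun n ↦ by
    rw [Complex.ofReal_div, Complex.ofReal_cpow n.cast_nonneg]
    simp
  have hz : zetaR x = ∑' n : ℕ, 1 / (n : ℝ) ^ x := by
    rw [zetaR, zeta_eq_tsum_one_div_nat_cpow (by simpa using hx)]
    simp_rw [hterm]
    rw [← Complex.ofReal_tsum, Complex.ofReal_re]
  rw [hz]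
  simpa using (Real.summable_one_div_nat_rpow.2 hx).le_tsum 1 fun n _ ↦ by positivity

theorem half_le_Gamma {x : ℝ} (hx : 0 < x) : 1 / 2 ≤ Real.Gamma x := by
  have two_le : ∀ y : ℝ, 2 ≤ y → 1 ≤ Real.Gamma y := fun y hy ↦ by
    simpa using Real.Gamma_strictMonoOn_Ici.monotoneOn (Set.mem_Ici.2 le_rfl) hy hy
  have one_le : ∀ y : ℝ, 1 ≤ y → 1 / 2 ≤ Real.Gamma y := fun y hy ↦ by
    rcases le_total 2 y with h | h
    · linarith [two_le y h]
    · have h1 := two_le (y + 1) (by linarith)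
      rw [Real.Gamma_add_one (by linarith)] at h1
      nlinarith [Real.Gamma_pos_of_pos hx, Real.Gamma_pos_of_pos (show 0 < y by linarith)]
  rcases le_total 1 x with h | h
  · exact one_le x h
  · have h1 := one_le (x + 1) (by linarith)
    rw [Real.Gamma_add_one hx.ne'] at h1
    nlinarith [Real.Gamma_pos_of_pos hx]

theorem A_pos (n : ℕ) : 0 < A n := by
  unfold A
  have : ∀ j ∈ Finset.Icc 1 (n - 1),
      (0 : ℝ) < (2 * π) ^ (2 * j) / (Nat.factorial (2 * j - 1)) := fun j _ ↦ by positivity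
  exact mul_pos (by positivity) (Finset.prod_pos this)

theorem A_succ {n : ℕ} (hn : 1 ≤ n) :
    A (n + 1) = (2 * π) ^ (2 * n + 1) / (n * Nat.factorial (2 * n - 1)) * A n := by
  obtain ⟨m, rfl⟩ := Nat.exists_eq_add_of_le' hn
  simp only [A, Nat.add_sub_cancel]
  rw [Finset.prod_Icc_succ_top (by omega), Nat.factorial_succ m]
  push_cast
  field_simp
  ring

theorem two_pi_pow_lt {n : ℕ} (hn : 9 ≤ n) :
    (2 * π) ^ (2 * n + 1) < n * Nat.factorial (2 * n - 1) := by
  have hpi : 2 * π ≤ 6.3 := by linarith [Real.pi_lt_d2]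
  refine (pow_le_pow_left₀ (by positivity) hpi _).trans_lt ?_
  induction n, hn using Nat.le_induction with
  | base => norm_num [Nat.factorial]
  | succ n hn ih =>
    have hf : Nat.factorial (2 * (n + 1) - 1) = (2 * n + 1) * (2 * n * Nat.factorial (2 * n - 1)) := by
      rw [show 2 * (n + 1) - 1 = 2 * n + 1 by omega, Nat.factorial_succ,
        ← Nat.mul_factorial_pred (show 2 * n ≠ 0 by omega)]
    have hn' : (9 : ℝ) ≤ n := by exact_mod_cast hn
    rw [hf, show 2 * (n + 1) + 1 = 2 * n + 1 + 2 by ring, pow_add]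
    push_cast
    have hF : (0 : ℝ) < (n : ℝ) * Nat.factorial (2 * n - 1) := by positivity
    calc (6.3 : ℝ) ^ (2 * n + 1) * 6.3 ^ 2
        < ((n : ℝ) * Nat.factorial (2 * n - 1)) * 6.3 ^ 2 := by gcongr
      _ ≤ ((n : ℝ) * Nat.factorial (2 * n - 1)) * ((n + 1) * (2 * n + 1) * 2) := by
          gcongr
          nlinarith
      _ = _ := by ring

theorem A_succ_lt {n : ℕ} (hn : 9 ≤ n) : A (n + 1) < A n := by
  rw [A_succ (by omega)]
  refine mul_lt_of_lt_one_left (A_pos n) ((div_lt_one ?_).2 (two_pi_pow_lt hn))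
  have : (0 : ℝ) < n := by exact_mod_cast (by omega : 0 < n)
  positivity

theorem A_nine_le : A 9 ≤ 4 * A 8 := by
  rw [A_succ (n := 8) (by norm_num)]
  refine mul_le_mul_of_nonneg_right ?_ (A_pos 8).le
  rw [div_le_iff₀ (by positivity)]
  have hpi : 2 * π ≤ 6.3 := by linarith [Real.pi_lt_d2]
  refine (pow_le_pow_left₀ (by positivity) hpi _).trans ?_
  norm_num [Nat.factorial]

theorem le_A_eight : (10 : ℝ) ^ 10 ≤ A 8 := by
  have hA : A 8 = (2 * π) ^ 64 / (5040 * (6 * 120 * 5040 * 362880 * 39916800 * 6227020800)) := by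
    simp only [A]
    norm_num [Finset.prod_Icc_succ_top, Nat.factorial]
    ring
  have hpi : 6.28 ≤ 2 * π := by linarith [Real.pi_gt_d2]
  rw [hA, le_div_iff₀ (by norm_num)]
  refine le_trans ?_ (pow_le_pow_left₀ (by norm_num) hpi _)
  norm_num

/-- The factor of the base of `a₂` that depends on neither `n` nor `d`. -/
noncomputable def gammaZetaFactor (δ : ℝ) : ℝ :=
  (Real.Gamma ((1 + δ) / 2) * zetaR (1 + δ)) ^ 2 / (π ^ (1 + δ) * Real.exp 0.92)

theorem le_gammaZetaFactor {δ : ℝ} (hδ : 0 < δ) (hδ' : δ ≤ 9) :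
    1 / (12 * 3.15 ^ 10) ≤ gammaZetaFactor δ := by
  have hz : 1 ≤ zetaR (1 + δ) := one_le_zetaR (by linarith)
  have hg : 1 / 2 ≤ Real.Gamma ((1 + δ) / 2) := half_le_Gamma (by linarith)
  have hnum : 1 / 4 ≤ (Real.Gamma ((1 + δ) / 2) * zetaR (1 + δ)) ^ 2 := by
    nlinarith [mul_le_mul hg hz zero_le_one (by linarith)]
  have hpi : π ^ (1 + δ) ≤ 3.15 ^ 10 := calc
    π ^ (1 + δ) ≤ π ^ (10 : ℝ) :=
      Real.rpow_le_rpow_of_exponent_le (by linarith [Real.pi_gt_three]) (by linarith)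
    _ = π ^ 10 := by norm_cast
    _ ≤ 3.15 ^ 10 := pow_le_pow_left₀ Real.pi_pos.le Real.pi_lt_d2.le _
  have hexp : Real.exp 0.92 ≤ 3 :=
    (Real.exp_le_exp.2 (by norm_num)).trans (by linarith [Real.exp_one_lt_d9] : Real.exp 1 ≤ 3)
  calc (1 : ℝ) / (12 * 3.15 ^ 10) = (1 / 4) / (3.15 ^ 10 * 3) := by norm_num
    _ ≤ gammaZetaFactor δ := by
      unfold gammaZetaFactor
      gcongr

theorem gammaZetaFactor_pos {δ : ℝ} (hδ : 0 < δ) (hδ' : δ ≤ 9) : 0 < gammaZetaFactor δ :=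
  lt_of_lt_of_le (by norm_num) (le_gammaZetaFactor hδ hδ')

theorem a₂_eq (n d : ℕ) (δ : ℝ) :
    a₂ n d δ = (gammaZetaFactor δ * A n * (25 * δ * (1 + δ)) ^ ((2 : ℝ) / d))
      ^ ((2 : ℝ) / (2 * (n : ℝ) ^ 2 - (n : ℝ) - 2 - 2 * δ)) := rfl

theorem a₂_exponent_denom_pos {n : ℕ} (hn : 4 ≤ n) {δ : ℝ} (hδ : δ ≤ 9) :
    0 < 2 * (n : ℝ) ^ 2 - (n : ℝ) - 2 - 2 * δ := by
  have : (4 : ℝ) ≤ n := by exact_mod_cast hn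
  nlinarith

theorem rpow_lt_max_one {b c p q : ℝ} (hc : 0 < c) (hcb : c < b) (hp : 0 < p) (hpq : p ≤ q) :
    c ^ p < max 1 (b ^ q) := by
  rcases lt_or_ge c 1 with h | h
  · exact lt_max_of_lt_left (Real.rpow_lt_one hc.le h hp)
  · exact lt_max_of_lt_right <| (Real.rpow_lt_rpow hc.le hcb hp).trans_le <|
      Real.rpow_le_rpow_of_exponent_le (h.trans hcb.le) hpq

theorem rpow_lt_rpow_of_le_four_mul {b c p q : ℝ} (hb : 256 ≤ b) (hc : 0 ≤ c) (hcb : c ≤ 4 * b)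
    (hp : 0 < p) (hpq : 5 / 4 * p < q) : c ^ p < b ^ q := by
  have h4 : (4 : ℝ) ≤ b ^ (1 / 4 : ℝ) := calc
    (4 : ℝ) = (256 : ℝ) ^ (1 / 4 : ℝ) := by
      rw [show (256 : ℝ) = 4 ^ (4 : ℝ) by norm_num, ← Real.rpow_mul (by norm_num)]
      norm_num
    _ ≤ b ^ (1 / 4 : ℝ) := by gcongr
  have hb0 : 0 < b := by linarith
  calc c ^ p ≤ (b ^ (1 / 4 : ℝ) * b) ^ p := by
        gcongr
        exact hcb.trans (by gcongr)
    _ = b ^ (5 / 4 * p) := by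
        rw [← Real.rpow_add_one hb0.ne', ← Real.rpow_mul hb0.le]
        norm_num
    _ < b ^ q := Real.rpow_lt_rpow_of_exponent_lt (by linarith) hpq

/-- **Lemma 1.** For `δ ∈ [0.04, 9]` and `n ≥ 4`, the map `d ↦ a₂(n,d,δ)` is strictly
decreasing on positive integers; moreover for `n ≥ 8` one has
`a₂(n+1,d,δ) < max 1 (a₂(n,d,δ))`. -/
theorem a₂_monotonicity (δ : ℝ) (hδ : δ ∈ Set.Icc (0.04 : ℝ) 9) :
    (∀ n : ℕ, 4 ≤ n → ∀ d₁ d₂ : ℕ, 0 < d₁ → d₁ < d₂ → a₂ n d₂ δ < a₂ n d₁ δ) ∧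
    (∀ n : ℕ, 8 ≤ n → ∀ d : ℕ, 0 < d → a₂ (n + 1) d δ < max 1 (a₂ n d δ)) := by
  obtain ⟨hδ₁, hδ₂⟩ := hδ
  have hδ₀ : 0 < δ := by linarith
  have hX : 1 < 25 * δ * (1 + δ) := by nlinarith
  have hC := gammaZetaFactor_pos hδ₀ hδ₂
  refine ⟨fun n hn d₁ d₂ hd₁ hd ↦ ?_, fun n hn d hd ↦ ?_⟩
  · have hA := A_pos n
    have hE := a₂_exponent_denom_pos hn hδ₂
    rw [a₂_eq, a₂_eq]
    have hexp : (2 : ℝ) / d₂ < 2 / d₁ := by gcongr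
    have hpow := Real.rpow_lt_rpow_of_exponent_lt hX hexp
    refine Real.rpow_lt_rpow (by positivity) ?_ (by positivity)
    gcongr
  · have hA := A_pos (n + 1)
    have hE := a₂_exponent_denom_pos (show 4 ≤ n by omega) hδ₂
    have hE' := a₂_exponent_denom_pos (show 4 ≤ n + 1 by omega) hδ₂
    rw [a₂_eq, a₂_eq]
    have hY : 1 ≤ (25 * δ * (1 + δ)) ^ ((2 : ℝ) / d) := Real.one_le_rpow hX.le (by positivity)
    rcases hn.eq_or_lt with rfl | hn
    · refine lt_max_of_lt_right (rpow_lt_rpow_of_le_four_mul ?_ (by positivity) ?_ (by positivity) ?_)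
      · calc (256 : ℝ) ≤ 1 / (12 * 3.15 ^ 10) * 10 ^ 10 * 1 := by norm_num
          _ ≤ gammaZetaFactor δ * A 8 * (25 * δ * (1 + δ)) ^ ((2 : ℝ) / d) := by
            have := A_pos 8
            gcongr
            · exact le_gammaZetaFactor hδ₀ hδ₂
            · exact le_A_eight
      · calc gammaZetaFactor δ * A 9 * (25 * δ * (1 + δ)) ^ ((2 : ℝ) / d)
            ≤ gammaZetaFactor δ * (4 * A 8) * (25 * δ * (1 + δ)) ^ ((2 : ℝ) / d) := by
              gcongr
              exact A_nine_le
          _ = _ := by ring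
      · rw [← mul_div_assoc, div_lt_div_iff₀ hE' hE]
        push_cast
        linarith
    · refine rpow_lt_max_one (by positivity) ?_ (by positivity) ?_
      · gcongr
        exact A_succ_lt hn
      · refine div_le_div_of_nonneg_left (by norm_num) hE ?_
        push_cast
        nlinarith [show (9 : ℝ) ≤ n by exact_mod_cast hn]
end

section
/- Let δ ∈ [0.02, 6.5] be a real number and let n ≥ 3 be an integer with 2δ < n² + 2n − 2. Then the function d ↦ f₃(n,d,δ) is strictly decreasing on the positive integers d. Furthermore, if n ≥ 7, then for every positive integer d, f₃(n+1,d,δ) < max(1, f₃(n,d,δ)). -/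
open Real Finset

/-- The function `f₃(n,d,δ)` from §8.1 of the paper. -/
noncomputable def f₃ (n d : ℕ) (δ : ℝ) : ℝ :=
  (2 * (Real.Gamma (1 + δ) * zetaR (1 + δ) ^ 2) / ((2 * π) ^ (1 + δ) * Real.exp 0.1)
      * (∏ j ∈ Finset.Icc 1 n, (2 * π) ^ (j + 1) / (Nat.factorial j))
      * (50 * δ * (1 + δ)) ^ ((1 : ℝ) / d))
    ^ ((2 : ℝ) / ((n : ℝ) ^ 2 + 2 * (n : ℝ) - 2 * δ - 2))

theorem one_div_le_Gamma_one_add {x : ℝ} (hx : 0 < x) : 1 / (1 + x) ≤ Gamma (1 + x) := by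
  have hmono : Gamma 2 ≤ Gamma (1 + x + 1) :=
    Gamma_strictMonoOn_Ici.monotoneOn (by simp) (by simp; linarith) (by linarith)
  rw [Gamma_two, Gamma_add_one (by positivity)] at hmono
  rw [div_le_iff₀ (by positivity)]
  linarith

/-- The part of the base of the power `f₃` that does not depend on the degree `d`. -/
noncomputable def volumeFactor (n : ℕ) (δ : ℝ) : ℝ :=
  2 * (Gamma (1 + δ) * zetaR (1 + δ) ^ 2) / ((2 * π) ^ (1 + δ) * exp 0.1)
    * ∏ j ∈ Icc 1 n, (2 * π) ^ (j + 1) / (Nat.factorial j)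

/-- The logarithm of the ratio of consecutive values of `volumeFactor`. -/
noncomputable def logRatio (n : ℕ) : ℝ :=
  (n + 2) * log (2 * π) - log (Nat.factorial (n + 1))

theorem volumeFactor_pos (n : ℕ) {δ : ℝ} (hδ : 0 < δ) : 0 < volumeFactor n δ := by
  have hz : 0 < zetaR (1 + δ) := zero_lt_one.trans_le (one_le_zetaR (by linarith))
  have hg : 0 < Gamma (1 + δ) := Gamma_pos_of_pos (by linarith)
  unfold volumeFactor
  have := prod_pos (s := Icc 1 n)
    fun j _ => (by positivity : 0 < (2 * π) ^ (j + 1) / (Nat.factorial j : ℝ))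
  positivity

theorem log_volumeFactor_succ (n : ℕ) {δ : ℝ} (hδ : 0 < δ) :
    log (volumeFactor (n + 1) δ) = log (volumeFactor n δ) + logRatio n := by
  have h : volumeFactor (n + 1) δ
      = volumeFactor n δ * ((2 * π) ^ (n + 1 + 1) / (Nat.factorial (n + 1))) := by
    rw [volumeFactor, volumeFactor, prod_Icc_succ_top (by omega), mul_assoc]
  rw [h, log_mul (volumeFactor_pos n hδ).ne' (by positivity),
    log_div (by positivity) (by positivity), log_pow, logRatio]
  push_cast
  ring

theorem logRatio_succ (n : ℕ) :
    logRatio (n + 1) = logRatio n + log (2 * π) - log (n + 2) := by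
  have h : ((n + 1 + 1 : ℕ) : ℝ) = n + 2 := by
    push_cast
    ring
  rw [logRatio, logRatio, Nat.factorial_succ (n + 1), Nat.cast_mul,
    log_mul (x := ((n + 1 + 1 : ℕ) : ℝ)) (by positivity) (by positivity), h, Nat.cast_succ]
  ring

theorem logRatio_succ_lt {n : ℕ} (hn : 7 ≤ n) : logRatio (n + 1) < logRatio n := by
  have hn' : (7 : ℝ) ≤ n := by exact_mod_cast hn
  have := log_lt_log (by positivity) (by linarith [pi_lt_four] : 2 * π < n + 2)
  linarith [logRatio_succ n]

theorem one_le_log_two_pi : 1 ≤ log (2 * π) := by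
  rw [le_log_iff_exp_le (by positivity)]
  linarith [exp_one_lt_d9, pi_gt_three]

theorem logRatio_seven_le : logRatio 7 ≤ 9 * log (2 * π) - 15 * log 2 := by
  have h : logRatio 7 = 9 * log (2 * π) - log 40320 := by
    rw [logRatio, show Nat.factorial (7 + 1) = 40320 from rfl, Nat.cast_ofNat, Nat.cast_ofNat]
    norm_num only
  have hl : log ((2 : ℝ) ^ 15) ≤ log 40320 := log_le_log (by norm_num) (by norm_num)
  rw [log_pow, Nat.cast_ofNat] at hl
  linarith

theorem log_volumeFactor_seven_ge {δ : ℝ} (hδ : δ ∈ Set.Icc (0.02 : ℝ) 6.5) :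
    (34 - δ) * log (2 * π) - 39 * log 2 - 0.1 ≤ log (volumeFactor 7 δ) := by
  obtain ⟨h1, h2⟩ := hδ
  have hpos : 0 < δ := by linarith
  have hz := one_le_zetaR (by linarith : 1 < 1 + δ)
  have hg : 1 / 8 ≤ Gamma (1 + δ) :=
    (one_div_le_one_div_of_le (by linarith) (by linarith)).trans (one_div_le_Gamma_one_add hpos)
  have hgz : 1 / 8 ≤ Gamma (1 + δ) * zetaR (1 + δ) ^ 2 :=
    hg.trans (le_mul_of_one_le_right (by linarith) (one_le_pow₀ hz))
  have hprod : ∏ j ∈ Icc 1 7, (2 * π) ^ (j + 1) / (Nat.factorial j : ℝ)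
      = (2 * π) ^ 35 / 125411328000 := by
    norm_num [prod_Icc_succ_top, Nat.factorial]
    ring
  have hle : (2 * π) ^ 35 / ((2 * π) ^ (1 + δ) * exp 0.1 * 2 ^ 39) ≤ volumeFactor 7 δ := by
    calc (2 * π) ^ 35 / ((2 * π) ^ (1 + δ) * exp 0.1 * 2 ^ 39)
        = 1 / 2 ^ 39 * ((2 * π) ^ 35 / ((2 * π) ^ (1 + δ) * exp 0.1)) := by field_simp
      _ ≤ 2 * (Gamma (1 + δ) * zetaR (1 + δ) ^ 2) / 125411328000
            * ((2 * π) ^ 35 / ((2 * π) ^ (1 + δ) * exp 0.1)) := by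
          refine mul_le_mul_of_nonneg_right ?_ (by positivity)
          rw [div_le_div_iff₀ (by positivity) (by positivity)]
          linarith
      _ = volumeFactor 7 δ := by
          rw [volumeFactor, hprod]
          field_simp
  refine le_trans (le_of_eq ?_) (log_le_log (by positivity) hle)
  rw [log_div (by positivity) (by positivity),
    log_mul (y := 2 ^ 39) (by positivity) (by positivity),
    log_mul (y := exp 0.1) (by positivity) (by positivity), log_rpow (by positivity), log_exp,
    log_pow, log_pow, Nat.cast_ofNat, Nat.cast_ofNat]
  ring

theorem volumeFactor_seven_base {δ : ℝ} (hδ : δ ∈ Set.Icc (0.02 : ℝ) 6.5) :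
    (61 - 2 * δ) * logRatio 7 < 17 * log (volumeFactor 7 δ) := by
  have h := log_volumeFactor_seven_ge hδ
  obtain ⟨h1, h2⟩ := hδ
  have hδL : δ * 1 ≤ δ * log (2 * π) := by
    gcongr
    exact one_le_log_two_pi
  have hr := mul_le_mul_of_nonneg_left logRatio_seven_le
    (by linarith : 0 ≤ 61 - 2 * δ)
  nlinarith [one_le_log_two_pi, log_two_gt_d9, log_two_lt_d9]

theorem volumeFactor_bounds {δ : ℝ} (hδ : δ ∈ Set.Icc (0.02 : ℝ) 6.5) {n : ℕ} (hn : 7 ≤ n)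
    (hr : 0 ≤ logRatio n) : 0 ≤ log (volumeFactor n δ) ∧
      ((n : ℝ) ^ 2 + 2 * n - 2 * δ - 2) * logRatio n < (2 * n + 3) * log (volumeFactor n δ) := by
  have hpos : 0 < δ := by linarith [hδ.1]
  induction n, hn using Nat.le_induction with
  | base =>
    have h := volumeFactor_seven_base hδ
    have := mul_nonneg (by linarith [hδ.2] : 0 ≤ 61 - 2 * δ) hr
    refine ⟨by linarith, ?_⟩
    push_cast
    linarith
  | succ n hn ih =>
    have hlt := logRatio_succ_lt hn
    obtain ⟨hB, hD⟩ := ih (hr.trans hlt.le)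
    have hn' : (7 : ℝ) ≤ n := by exact_mod_cast hn
    rw [log_volumeFactor_succ n hpos]
    refine ⟨by linarith, ?_⟩
    have hE : 0 ≤ ((n : ℝ) + 1) ^ 2 + 2 * (n + 1) - 2 * δ - 2 := by nlinarith [hδ.2]
    have := mul_le_mul_of_nonneg_left hlt.le hE
    push_cast
    nlinarith

theorem f₃_eq_exp (n d : ℕ) {δ : ℝ} (hδ : 0 < δ) :
    f₃ n d δ = exp ((log (volumeFactor n δ) + log (50 * δ * (1 + δ)) / d)
      * (2 / ((n : ℝ) ^ 2 + 2 * n - 2 * δ - 2))) := by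
  have hv := volumeFactor_pos n hδ
  change (volumeFactor n δ * _) ^ _ = _
  rw [rpow_def_of_pos (by positivity), log_mul hv.ne' (by positivity), log_rpow (by positivity)]
  ring_nf

/-- **Lemma 2.** For `δ ∈ [0.02, 6.5]` and `n ≥ 3` with `2δ < n² + 2n − 2`, the map
`d ↦ f₃(n,d,δ)` is strictly decreasing on positive integers; moreover if `n ≥ 7` then
`f₃(n+1,d,δ) < max 1 (f₃(n,d,δ))` for every positive integer `d`. -/
theorem f₃_monotonicity (δ : ℝ) (hδ : δ ∈ Set.Icc (0.02 : ℝ) 6.5) (n : ℕ) (hn : 3 ≤ n)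
    (hδn : 2 * δ < (n : ℝ) ^ 2 + 2 * (n : ℝ) - 2) :
    (∀ d₁ d₂ : ℕ, 0 < d₁ → d₁ < d₂ → f₃ n d₂ δ < f₃ n d₁ δ) ∧
    (7 ≤ n → ∀ d : ℕ, 0 < d → f₃ (n + 1) d δ < max 1 (f₃ n d δ)) := by
  have hpos : 0 < δ := by linarith [hδ.1]
  have hC : 0 < log (50 * δ * (1 + δ)) := log_pos (by nlinarith [hδ.1])
  have hE : 0 < (n : ℝ) ^ 2 + 2 * n - 2 * δ - 2 := by linarith
  constructor
  · intro d₁ d₂ h₁ h₁₂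
    rw [f₃_eq_exp n d₁ hpos, f₃_eq_exp n d₂ hpos]
    gcongr
  · intro h7 d hd
    have hE' : 0 < ((n + 1 : ℕ) : ℝ) ^ 2 + 2 * (n + 1 : ℕ) - 2 * δ - 2 := by push_cast; nlinarith
    rw [f₃_eq_exp n d hpos, f₃_eq_exp (n + 1) d hpos, log_volumeFactor_succ n hpos, lt_max_iff]
    have hc : 0 < log (50 * δ * (1 + δ)) / d := by positivity
    set c := log (50 * δ * (1 + δ)) / d
    rcases lt_or_ge (log (volumeFactor n δ) + logRatio n + c) 0 with h | h
    · exact Or.inl (by rw [exp_lt_one_iff]; exact mul_neg_of_neg_of_pos h (by positivity))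
    · right
      rw [exp_lt_exp, mul_div_assoc', mul_div_assoc', div_lt_div_iff₀ hE' hE]
      have key : ((n : ℝ) ^ 2 + 2 * n - 2 * δ - 2) * logRatio n
          < (2 * n + 3) * (log (volumeFactor n δ) + c) := by
        rcases lt_or_ge (logRatio n) 0 with hr | hr
        · exact (mul_neg_of_pos_of_neg hE hr).trans_le
            (mul_nonneg (by positivity) (by linarith))
        · have := (volumeFactor_bounds hδ h7 hr).2
          nlinarith [mul_pos (by positivity : (0 : ℝ) < 2 * n + 3) hc]
      push_cast
      nlinarith
end

section
/- Let ℓ be a totally real number field of degree 4 over ℚ which contains a subfield isomorphic to ℚ(√5). If the absolute value D_ℓ of the discriminant of ℓ satisfies D_ℓ > 55⁴, then the regulator R_ℓ of ℓ satisfies R_ℓ > 1.64. -/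
open NumberField

/-- The discriminant of a number field is bounded by that of any independent family of integers. -/
theorem abs_discr_le_norm_det_sq {K : Type*} [Field K] [NumberField K] {n : ℕ}
    (e : Fin n ≃ (K →ₐ[ℚ] ℂ)) (v : Fin n → 𝓞 K)
    (h : (Matrix.of fun i j ↦ e j (v i : K)).det ≠ 0) :
    |(NumberField.discr K : ℝ)| ≤ ‖(Matrix.of fun i j ↦ e j (v i : K)).det‖ ^ 2 := by
  classical
  have hcard : Fintype.card (Module.Free.ChooseBasisIndex ℤ (𝓞 K)) = Fintype.card (Fin n) := by
    rw [← Module.finrank_eq_card_basis (integralBasis K), Fintype.card_congr e,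
      AlgHom.card ℚ K ℂ]
  let f := Fintype.equivOfCardEq hcard
  let b := (integralBasis K).reindex f
  let P : Matrix (Fin n) (Fin n) ℤ :=
    Matrix.of fun i j ↦ (RingOfIntegers.basis K).repr (v j) (f.symm i)
  have hP : b.toMatrix (fun j ↦ (v j : K)) = P.map (algebraMap ℤ ℚ) := by
    ext i j
    simp [b, P, Module.Basis.toMatrix_apply]
  have hdisc : Algebra.discr ℚ (fun j ↦ (v j : K)) =
      ((P.det ^ 2 * NumberField.discr K : ℤ) : ℚ) := by
    have h1 := Algebra.discr_of_matrix_vecMul (A := ℚ) b (b.toMatrix (fun j ↦ (v j : K)))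
    have h2 : ((P.map (algebraMap ℤ ℚ)).det) = (P.det : ℚ) := by
      have := RingHom.map_det (algebraMap ℤ ℚ) P
      simpa using this.symm
    rw [b.toMatrix_map_vecMul, hP, h2] at h1
    rw [h1, Int.cast_mul, coe_discr, ← Algebra.discr_reindex ℚ (integralBasis K) f]
    simp [b]
  have hdet : (((P.det ^ 2 * NumberField.discr K : ℤ) : ℚ) : ℂ) =
      (Matrix.of fun i j ↦ e j (v i : K)).det ^ 2 := by
    have := Algebra.discr_eq_det_embeddingsMatrixReindex_pow_two ℚ ℂ (fun j ↦ (v j : K)) e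
    rw [hdisc] at this
    exact this
  have hP0 : P.det ≠ 0 := by
    intro h0
    rw [h0] at hdet
    apply h
    simpa using hdet.symm
  rw [← norm_pow, ← hdet]
  generalize P.det = d at hP0
  have : (1 : ℝ) ≤ (d : ℝ) ^ 2 := by
    have : 0 < d ^ 2 := by positivity
    exact_mod_cast this
  push_cast
  rw [norm_mul, norm_pow, Complex.norm_intCast, Complex.norm_intCast, sq_abs]
  nlinarith [abs_nonneg (NumberField.discr K : ℝ)]

/-- The embeddings of a quartic field containing `√5` can be numbered so that `e 0`, `e 1` agree on
`ℚ(√5)`, as do `e 2`, `e 3`, and both pairs are swapped by the relative Galois involution. -/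
theorem exists_equiv_embeddings_of_quartic {L : Type*} [Field L] [NumberField L]
    (hdeg : Module.finrank ℚ L = 4) {x : L} (hx : x ^ 2 = 5) (ψ : L →ₐ[ℚ] ℂ) :
    ∃ e : Fin 4 ≃ (L →ₐ[ℚ] ℂ), e 3 = ψ ∧ e 2 x = ψ x ∧ e 0 x = -ψ x ∧ e 1 x = -ψ x ∧
      ∀ u, e 0 u = e 1 u ↔ e 2 u = e 3 u := by
  classical
  have hx0 : ψ x ≠ 0 := by
    rw [map_ne_zero]
    rintro rfl
    norm_num at hx
  have hirr : Irreducible (Polynomial.X ^ 2 - Polynomial.C 5 : Polynomial ℚ) := by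
    refine X_pow_sub_C_irreducible_of_prime Nat.prime_two fun b hb ↦ ?_
    have h5 : IsSquare ((5 : ℕ) : ℚ) := ⟨b, by rw [← sq, hb]; norm_num⟩
    rw [Rat.isSquare_natCast_iff] at h5
    exact (by norm_num : Nat.Prime 5).prime.not_isSquare h5
  have hmin : minpoly ℚ x = Polynomial.X ^ 2 - Polynomial.C 5 := by
    refine (minpoly.eq_of_irreducible_of_monic hirr ?_ ?_).symm
    · simp [hx]
    · exact Polynomial.monic_X_pow_sub_C _ two_ne_zero
  let k := IntermediateField.adjoin ℚ {x}
  have hk : Module.finrank ℚ k = 2 := by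
    rw [IntermediateField.adjoin.finrank (Algebra.IsIntegral.isIntegral x), hmin]
    exact Polynomial.natDegree_X_pow_sub_C
  have hkL : Module.finrank k L = 2 := by
    have := Module.finrank_mul_finrank ℚ k L
    rw [hk, hdeg] at this
    omega
  have : Algebra.IsQuadraticExtension k L := { finrank_eq_two' := hkL }
  have hgal : Nat.card Gal(L/k) = 2 := by rw [IsGalois.card_aut_eq_finrank, hkL]
  have : Nontrivial Gal(L/k) := by
    rw [← Finite.one_lt_card_iff_nontrivial]
    omega
  obtain ⟨τ, hτ⟩ := exists_ne (1 : Gal(L/k))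
  have hτx : τ x = x := τ.commutes ⟨x, IntermediateField.mem_adjoin_simple_self ℚ x⟩
  obtain ⟨σ, hσ⟩ : ∃ σ : L →ₐ[ℚ] ℂ, σ x = -ψ x := by
    have h1 : -ψ x ∈ (minpoly ℚ x).rootSet ℂ := by
      rw [Polynomial.mem_rootSet, hmin]
      refine ⟨(Polynomial.monic_X_pow_sub_C _ two_ne_zero).ne_zero, ?_⟩
      have : (ψ x) ^ 2 = 5 := by rw [← map_pow, hx, map_ofNat]
      simp [this]
    rw [← (NumberField.isAlgebraic L).range_eval_eq_rootSet_minpoly ℂ x] at h1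
    exact h1
  let t : L →ₐ[ℚ] L := (τ.restrictScalars ℚ : L →ₐ[ℚ] L)
  have ht : ∀ y, t y = τ y := fun _ ↦ rfl
  obtain ⟨z, hz⟩ : ∃ z, τ z ≠ z := by
    by_contra! hall
    exact hτ (AlgEquiv.ext hall)
  have hne (φ : L →ₐ[ℚ] ℂ) : φ ≠ φ.comp t := fun h ↦
    hz (φ.injective (by simpa [ht] using (DFunLike.congr_fun h z).symm))
  have hne' (φ φ' : L →ₐ[ℚ] ℂ) (h : φ x = -ψ x) (h' : φ' x = ψ x) : φ ≠ φ' := by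
    rintro rfl
    rw [h'] at h
    exact hx0 (self_eq_neg.mp h)
  have hψt : (ψ.comp t) x = ψ x := by simp [ht, hτx]
  have hσt : (σ.comp t) x = -ψ x := by simp [ht, hτx, hσ]
  let g : Fin 4 → (L →ₐ[ℚ] ℂ) := ![σ, σ.comp t, ψ.comp t, ψ]
  have hg : Function.Bijective g := by
    rw [Fintype.bijective_iff_injective_and_card]
    refine ⟨?_, by rw [AlgHom.card ℚ L ℂ, hdeg, Fintype.card_fin]⟩
    have h1 := hne σ
    have h2 := hne ψ
    have h3 := hne' _ _ hσ hψt
    have h4 := hne' _ _ hσ rfl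
    have h5 := hne' _ _ hσt hψt
    have h6 := hne' _ _ hσt rfl
    intro i j hij
    fin_cases i <;> fin_cases j <;>
      first
      | rfl
      | exact absurd hij h1 | exact absurd hij.symm h1
      | exact absurd hij h2 | exact absurd hij.symm h2
      | exact absurd hij h3 | exact absurd hij.symm h3
      | exact absurd hij h4 | exact absurd hij.symm h4
      | exact absurd hij h5 | exact absurd hij.symm h5
      | exact absurd hij h6 | exact absurd hij.symm h6
  refine ⟨Equiv.ofBijective g hg, rfl, hψt, hσ, hσt, fun u ↦ ?_⟩
  change σ u = σ (τ u) ↔ ψ (τ u) = ψ u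
  exact ⟨fun h ↦ congrArg ψ (σ.injective h).symm, fun h ↦ congrArg σ (ψ.injective h).symm⟩

theorem Matrix.det_relative_quadratic {R : Type*} [CommRing R] (p q a b c d : R) :
    !![1, 1, 1, 1; p, p, q, q; a, b, c, d; p * a, p * b, q * c, q * d].det =
      (p - q) ^ 2 * (a - b) * (d - c) := by
  simp [Matrix.det_succ_row_zero, Fin.sum_univ_succ, Fin.succAbove]
  ring

theorem eq_one_and_eq_one_of_int_eq_sq_add_sq {a b : ℝ} (ha : 0 < a) (hb : 0 < b)
    (hab : a * b = 1) (hlog : |Real.log a| < 0.34) {T : ℤ} (hT : (T : ℝ) = 2 * (a ^ 2 + b ^ 2)) :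
    a = 1 ∧ b = 1 := by
  have hlog2 := Real.log_two_gt_d9
  have hlogb : Real.log a + Real.log b = 0 := by
    rw [← Real.log_mul ha.ne' hb.ne', hab, Real.log_one]
  rw [abs_lt] at hlog
  have ha2 : a ^ 2 < 2 := by
    rw [← Real.log_lt_log_iff (by positivity) (by norm_num), Real.log_pow]
    push_cast
    linarith
  have hb2 : b ^ 2 < 2 := by
    rw [← Real.log_lt_log_iff (by positivity) (by norm_num), Real.log_pow]
    push_cast
    linarith
  have hab2 : a ^ 2 * b ^ 2 = 1 := by rw [← mul_pow, hab, one_pow]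
  have hT5 : T < 5 := by
    have : (T : ℝ) < 5 := by rw [hT]; nlinarith
    exact_mod_cast this
  have hT4 : (T : ℝ) ≤ 4 := by exact_mod_cast Int.lt_add_one_iff.mp hT5
  have h : (a - b) ^ 2 ≤ 0 := by nlinarith
  have h' : a = b := sub_eq_zero.mp (pow_eq_zero_iff two_ne_zero |>.mp (h.antisymm (sq_nonneg _)))
  subst h'
  have : a = 1 := by nlinarith
  exact ⟨this, this⟩

/-- In a totally real quartic field containing `√5`, of discriminant larger than `55⁴`, a unit with
small logarithms has all its conjugates of absolute value one. -/
theorem norm_eq_one_of_log_norm_lt {L : Type*} [Field L] [NumberField L]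
    (htr : ∀ φ : L →+* ℂ, NumberField.ComplexEmbedding.IsReal φ)
    {x : L} (hx : x ^ 2 = 5)
    (hD : (55 : ℝ) ^ 4 < |(NumberField.discr L : ℝ)|)
    (e : Fin 4 ≃ (L →ₐ[ℚ] ℂ)) (he2 : e 2 x = e 3 x) (he0 : e 0 x = -e 3 x)
    (he1 : e 1 x = -e 3 x) (he : ∀ u, e 0 u = e 1 u ↔ e 2 u = e 3 u) (u : (𝓞 L)ˣ)
    (h01 : |Real.log ‖e 0 u‖ + Real.log ‖e 1 u‖| < 0.68)
    (h1 : |Real.log ‖e 1 u‖| < 1.6) (h2 : |Real.log ‖e 2 u‖| < 1.6) (i : Fin 4) :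
    ‖e i u‖ = 1 := by
  have hpos (i) : 0 < ‖e i u‖ := by simp
  have hprod : ‖e 0 u‖ * ‖e 1 u‖ * ‖e 2 u‖ * ‖e 3 u‖ = 1 := by
    have h := Algebra.norm_eq_prod_embeddings ℚ ℂ (u : L)
    rw [← e.prod_comp, Fin.prod_univ_four] at h
    have hu := Units.norm L u
    rw [← norm_mul, ← norm_mul, ← norm_mul, ← h, eq_ratCast, Complex.norm_ratCast,
      ← Rat.cast_abs, hu, Rat.cast_one]
  have hlog : Real.log ‖e 0 u‖ + Real.log ‖e 1 u‖ + Real.log ‖e 2 u‖ + Real.log ‖e 3 u‖ = 0 := by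
    have hp := mul_pos (hpos 0) (hpos 1)
    rw [← Real.log_mul (hpos 0).ne' (hpos 1).ne', ← Real.log_mul hp.ne' (hpos 2).ne',
      ← Real.log_mul (mul_pos hp (hpos 2)).ne' (hpos 3).ne', hprod, Real.log_one]
  rw [abs_lt] at h01 h1 h2
  have hbig {y : ℝ} (hy : 0 < y) (h : Real.log y < 2.28) : y < 12.2 := by
    have h' : Real.log (y ^ 2) < 5 := by rw [Real.log_pow]; push_cast; linarith
    rw [Real.log_lt_iff_lt_exp (by positivity), ← mul_one 5, ← Nat.cast_ofNat (R := ℝ),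
      Real.exp_nat_mul] at h'
    have : Real.exp 1 ^ 5 < 2.7182818286 ^ 5 :=
      pow_lt_pow_left₀ Real.exp_one_lt_d9 (Real.exp_pos _).le (by norm_num)
    refine lt_of_pow_lt_pow_left₀ 2 (by norm_num) (h'.trans (this.trans ?_))
    norm_num
  have hsmall {y : ℝ} (hy : 0 < y) (h : Real.log y < 1.6) : y < 7.4 := by
    have h' : Real.log y < 2 := by linarith
    rw [Real.log_lt_iff_lt_exp hy, ← mul_one 2, ← Nat.cast_ofNat (R := ℝ),
      Real.exp_nat_mul] at h'
    have : Real.exp 1 ^ 2 < 2.7182818286 ^ 2 :=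
      pow_lt_pow_left₀ Real.exp_one_lt_d9 (Real.exp_pos _).le (by norm_num)
    refine h'.trans (this.trans ?_)
    norm_num
  have hb0 := hbig (hpos 0) (by linarith)
  have hb1 := hsmall (hpos 1) (by linarith)
  have hb2 := hsmall (hpos 2) (by linarith)
  have hb3 := hbig (hpos 3) (by linarith)
  have hX : (e 3 x) ^ 2 = 5 := by rw [← map_pow, hx, map_ofNat]
  have heq : e 0 u = e 1 u := by
    by_contra hne
    have hne' : e 2 u ≠ e 3 u := fun h ↦ hne ((he u).mpr h)
    have hint : IsIntegral ℤ ((1 + x) / 2) := by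
      refine ⟨Polynomial.X ^ 2 - Polynomial.X - 1, by monicity!, ?_⟩
      simp only [Polynomial.eval₂_sub, Polynomial.eval₂_X_pow, Polynomial.eval₂_X,
        Polynomial.eval₂_one]
      linear_combination hx / 4
    let φ : 𝓞 L := ⟨(1 + x) / 2, hint⟩
    have hφ : (φ : L) = (1 + x) / 2 := rfl
    let v : Fin 4 → 𝓞 L := ![1, φ, u, φ * u]
    have hdet : (Matrix.of fun i j ↦ e j (v i : L)).det =
        5 * (e 0 u - e 1 u) * (e 3 u - e 2 u) := by
      have hM : (Matrix.of fun i j ↦ e j (v i : L)) =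
          !![1, 1, 1, 1; e 0 φ, e 0 φ, e 3 φ, e 3 φ; e 0 u, e 1 u, e 2 u, e 3 u;
            e 0 φ * e 0 u, e 0 φ * e 1 u, e 3 φ * e 2 u, e 3 φ * e 3 u] := by
        ext i j
        fin_cases i <;> fin_cases j <;> simp [v, hφ, he0, he1, he2, map_ofNat]
      rw [hM, Matrix.det_relative_quadratic, hφ]
      simp only [map_div₀, map_add, map_one, map_ofNat, he0]
      congr 2
      linear_combination hX
    have hle := abs_discr_le_norm_det_sq e v (by
      rw [hdet]
      exact mul_ne_zero (mul_ne_zero (by norm_num) (sub_ne_zero.mpr hne))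
        (sub_ne_zero.mpr hne'.symm))
    rw [hdet, norm_mul, norm_mul, Complex.norm_ofNat] at hle
    have hA : ‖e 0 u - e 1 u‖ ≤ 19.6 := (norm_sub_le _ _).trans (by linarith)
    have hB : ‖e 3 u - e 2 u‖ ≤ 19.6 := (norm_sub_le _ _).trans (by linarith)
    have : (5 * ‖e 0 u - e 1 u‖ * ‖e 3 u - e 2 u‖) ^ 2 ≤ (5 * 19.6 * 19.6) ^ 2 := by gcongr
    norm_num at this hD
    linarith
  have heq' := (he u).mp heq
  have hsq (i) : (e i u) ^ 2 = ((‖e i u‖ ^ 2 : ℝ) : ℂ) := by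
    have h := RingHom.congr_fun (ComplexEmbedding.isReal_iff.mp (htr (e i).toRingHom)) (u : L)
    rw [ComplexEmbedding.conjugate_coe_eq] at h
    have h' : (starRingEnd ℂ) (e i u) = e i u := h
    rw [Complex.ofReal_pow, ← Complex.conj_mul', h', sq]
  have htrace : ∃ T : ℤ, (T : ℝ) = 2 * (‖e 0 u‖ ^ 2 + ‖e 2 u‖ ^ 2) := by
    refine ⟨Algebra.trace ℤ (𝓞 L) ((u : 𝓞 L) ^ 2), ?_⟩
    have h := trace_eq_sum_embeddings ℂ (K := ℚ) (x := (((u : 𝓞 L) ^ 2 : 𝓞 L) : L))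
    rw [← e.sum_comp, Fin.sum_univ_four, ← Algebra.coe_trace_int] at h
    simp only [map_pow, hsq, ← heq, ← heq'] at h
    apply Complex.ofReal_injective
    push_cast at h ⊢
    rw [eq_ratCast, Rat.cast_intCast] at h
    rw [h]
    ring
  obtain ⟨T, hT⟩ := htrace
  have h02 : ‖e 0 u‖ * ‖e 2 u‖ = 1 := by
    rw [← heq, ← heq'] at hprod
    have : (‖e 0 u‖ * ‖e 2 u‖) ^ 2 = 1 := by linear_combination hprod
    exact (pow_eq_one_iff_of_nonneg (mul_pos (hpos 0) (hpos 2)).le two_ne_zero).mp this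
  rw [← heq] at h01
  obtain ⟨hn0, hn2⟩ := eq_one_and_eq_one_of_int_eq_sq_add_sq (hpos 0) (hpos 2) h02
    (by rw [abs_lt]; constructor <;> linarith) hT
  fin_cases i
  · exact hn0
  · exact heq ▸ hn0
  · exact hn2
  · exact heq' ▸ hn2


open Units Units.dirichletUnitTheorem in
open scoped Classical in
/-- Minkowski's convex body theorem in the logarithmic space, for a symmetric box sheared in the
direction of one coordinate plane. -/
theorem exists_unit_logEmbedding_mem_sheared_box {K : Type*} [Field K] [NumberField K]
    {i j : {w : InfinitePlace K // w ≠ w₀}} (hij : i ≠ j) (r : {w : InfinitePlace K // w ≠ w₀} → ℝ)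
    (hr : ∀ w, 0 ≤ r w) (hreg : regulator K < ∏ w, r w) :
    ∃ u : (𝓞 K)ˣ, logEmbedding K (Additive.ofMul u) ≠ 0 ∧
      |logEmbedding K (Additive.ofMul u) i + logEmbedding K (Additive.ofMul u) j| < r i ∧
      ∀ w ≠ i, |logEmbedding K (Additive.ofMul u) w| < r w := by
  let t : Matrix.TransvectionStruct {w : InfinitePlace K // w ≠ w₀} ℝ := ⟨i, j, hij, 1⟩
  have hti (x : logSpace K) : Matrix.toLin' t.toMatrix x i = x i + x j := by
    simp [t, Matrix.TransvectionStruct.toMatrix, Matrix.transvection, Matrix.single_mulVec_eq]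
  have htw (x : logSpace K) {w} (hw : w ≠ i) : Matrix.toLin' t.toMatrix x w = x w := by
    simp [t, Matrix.TransvectionStruct.toMatrix, Matrix.transvection, Matrix.single_mulVec_eq, hw]
  let B : Set (logSpace K) := Set.univ.pi fun w ↦ Set.Ioo (-r w) (r w)
  let S : Set (logSpace K) := Matrix.toLin' t.toMatrix ⁻¹' B
  have hBmeas : MeasurableSet B := MeasurableSet.univ_pi fun _ ↦ measurableSet_Ioo
  have hcard : Fintype.card {w : InfinitePlace K // w ≠ w₀} = Module.finrank ℝ (logSpace K) :=
    (Module.finrank_fintype_fun_eq_card ℝ).symm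
  have hvol : MeasureTheory.volume S =
      ENNReal.ofReal ((∏ w, r w) * 2 ^ Module.finrank ℝ (logSpace K)) := by
    rw [(Real.volume_preserving_transvectionStruct t).measure_preimage hBmeas.nullMeasurableSet,
      Real.volume_pi_Ioo, ← ENNReal.ofReal_prod_of_nonneg (fun w _ ↦ by linarith [hr w]), ← hcard,
      ← Finset.card_univ, ← Finset.prod_const, ← Finset.prod_mul_distrib]
    congr 1
    exact Finset.prod_congr rfl fun w _ ↦ by ring
  let b := Module.Free.chooseBasis ℤ (unitLattice K)
  have fund := ZLattice.isAddFundamentalDomain b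
    (MeasureTheory.volume : MeasureTheory.Measure (logSpace K))
  have hcov := ZLattice.covolume_eq_measure_fundamentalDomain (unitLattice K)
    MeasureTheory.volume fund
  have hfin : MeasureTheory.volume
      (ZSpan.fundamentalDomain (b.ofZLatticeBasis ℝ (unitLattice K))) ≠ ⊤ :=
    (Bornology.IsBounded.measure_lt_top (ZSpan.fundamentalDomain_isBounded _)).ne
  have : Countable (unitLattice K).toAddSubgroup := inferInstanceAs (Countable (unitLattice K))
  obtain ⟨⟨y, hy⟩, hy0, hyS⟩ :=
    MeasureTheory.exists_ne_zero_mem_lattice_of_measure_mul_two_pow_lt_measure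
      (L := (unitLattice K).toAddSubgroup) (s := S) fund
      (fun x hx w hw ↦ by
        have := hx w hw
        rw [map_neg, Pi.neg_apply, Set.mem_Ioo]
        exact ⟨neg_lt_neg this.2, neg_lt.mp this.1⟩)
      ((convex_pi fun w _ ↦ convex_Ioo _ _).linear_preimage _) (by
        rw [hvol, ← ENNReal.ofReal_toReal hfin, ← MeasureTheory.measureReal_def, ← hcov,
          ENNReal.ofReal_mul (Finset.prod_nonneg fun w _ ↦ hr w), ENNReal.ofReal_pow (by norm_num),
          ENNReal.ofReal_ofNat]
        refine ENNReal.mul_lt_mul_left (by simp) (by finiteness) ?_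
        exact (ENNReal.ofReal_lt_ofReal_iff_of_nonneg (regulator_pos K).le).mpr hreg)
  obtain ⟨u, _, hu⟩ := hy
  have hu' : logEmbedding K (Additive.ofMul u.toMul) = y := hu
  refine ⟨u.toMul, ?_⟩
  rw [hu']
  refine ⟨fun h ↦ hy0 (Subtype.ext h), ?_, fun w hw ↦ ?_⟩
  · have := hyS i trivial
    rw [hti] at this
    exact abs_lt.mpr this
  · have := hyS w trivial
    rw [htw _ hw] at this
    exact abs_lt.mpr this

/-- **§5.4 of the paper.** If `ℓ` is a totally real quartic field containing `ℚ(√5)`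
(equivalently, containing a square root of `5`) whose absolute discriminant exceeds `55⁴`,
then its regulator exceeds `1.64`. -/
theorem regulator_gt_of_quartic_over_sqrt5 (L : Type*) [Field L] [NumberField L]
    (htr : ∀ φ : L →+* ℂ, NumberField.ComplexEmbedding.IsReal φ)
    (hdeg : Module.finrank ℚ L = 4)
    (hsub : ∃ x : L, x ^ 2 = 5)
    (hD : (55 : ℝ) ^ 4 < |(NumberField.discr L : ℝ)|) :
    (1.64 : ℝ) < NumberField.Units.regulator L := by
  classical
  obtain ⟨x, hx⟩ := hsub
  let w₀ : InfinitePlace L := Units.dirichletUnitTheorem.w₀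
  obtain ⟨e, h3, h2x, h0x, h1x, he⟩ :=
    exists_equiv_embeddings_of_quartic hdeg hx w₀.embedding.toRatAlgHom
  rw [← h3] at h2x h0x h1x
  let p (i : Fin 4) : InfinitePlace L := InfinitePlace.mk (e i : L →+* ℂ)
  have hp3 : p 3 = w₀ := by
    simp only [p, h3]
    exact InfinitePlace.mk_embedding w₀
  have hinj : Function.Injective p := fun i j hij ↦ by
    rw [InfinitePlace.mk_eq_iff, ComplexEmbedding.isReal_iff.mp (htr _), or_self] at hij
    exact e.injective (AlgHom.ext fun y ↦ RingHom.congr_fun hij y)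
  have hsurj : Function.Surjective p := fun w ↦
    ⟨e.symm w.embedding.toRatAlgHom, by
      simp only [p, Equiv.apply_symm_apply]
      exact InfinitePlace.mk_embedding w⟩
  have hne {i : Fin 4} (hi : i ≠ 3) : p i ≠ w₀ := hp3 ▸ hinj.ne hi
  let i₀ : {w : InfinitePlace L // w ≠ w₀} := ⟨p 0, hne (by decide)⟩
  let i₁ : {w : InfinitePlace L // w ≠ w₀} := ⟨p 1, hne (by decide)⟩
  let i₂ : {w : InfinitePlace L // w ≠ w₀} := ⟨p 2, hne (by decide)⟩
  have h01 : i₀ ≠ i₁ := fun h ↦ absurd (hinj (congrArg Subtype.val h)) (by decide)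
  have h02 : i₀ ≠ i₂ := fun h ↦ absurd (hinj (congrArg Subtype.val h)) (by decide)
  have hcard : Fintype.card {w : InfinitePlace L // w ≠ w₀} = 3 := by
    rw [Fintype.card_subtype_compl, Fintype.card_subtype_eq,
      ← Fintype.card_of_bijective ⟨hinj, hsurj⟩, Fintype.card_fin]
  let r : {w : InfinitePlace L // w ≠ w₀} → ℝ := fun w ↦ if w = i₀ then 0.68 else 1.6
  by_contra! hreg
  obtain ⟨u, hu0, hui, huw⟩ := exists_unit_logEmbedding_mem_sheared_box (K := L) h01 r
    (fun w ↦ by dsimp only [r]; split_ifs <;> norm_num) (by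
      have h : ∏ w ∈ Finset.univ.erase i₀, r w = 1.6 ^ 2 := by
        rw [Finset.prod_congr rfl fun w hw ↦ if_neg (Finset.ne_of_mem_erase hw),
          Finset.prod_const, Finset.card_erase_of_mem (Finset.mem_univ _), Finset.card_univ, hcard]
      rw [← Finset.mul_prod_erase _ _ (Finset.mem_univ i₀), h]
      simp only [r, if_pos]
      exact hreg.trans_lt (by norm_num))
  have hmult (w : InfinitePlace L) : w.mult = 1 := by
    have hw : w.IsReal := ⟨w.embedding, htr _, InfinitePlace.mk_embedding w⟩
    exact InfinitePlace.mult_isReal ⟨w, hw⟩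
  have hlog (w : {w : InfinitePlace L // w ≠ w₀}) :
      Units.logEmbedding L (Additive.ofMul u) w = Real.log (w.val u) := by
    rw [Units.dirichletUnitTheorem.logEmbedding_component, hmult, Nat.cast_one, one_mul]
  have hpu (i : Fin 4) : p i u = ‖e i u‖ := rfl
  have hu1 := huw i₁ h01.symm
  have hu2 := huw i₂ h02.symm
  rw [hlog, hlog] at hui
  rw [hlog] at hu1 hu2
  simp only [r, if_neg h01.symm, if_neg h02.symm, if_pos, i₀, i₁, i₂, hpu] at hui hu1 hu2
  have key := norm_eq_one_of_log_norm_lt htr hx hD e h2x h0x h1x he u hui hu1 hu2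
  refine hu0 (funext fun w ↦ ?_)
  obtain ⟨i, hi⟩ := hsurj w
  rw [hlog, ← hi, hpu, key, Real.log_one]
  rfl
end

section
/- Let k be a totally real number field and ℓ a totally complex quadratic extension of k. Then the homomorphism U_ℓ/U_ℓ³ → U_k/U_k³ induced by the norm map N_{ℓ/k} is surjective, and its kernel has order equal to the number of cube roots of unity contained in ℓ (which is 1 or 3). -/
open NumberField

/-- The homomorphism `U_ℓ/U_ℓᵐ → U_k/U_kᵐ` induced by the norm map `N_{ℓ/k}` on units of the
rings of integers. -/
noncomputable def normUnitQuotMap (k ℓ : Type*) [Field k] [NumberField k] [Field ℓ]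
    [NumberField ℓ] [Algebra k ℓ] [FiniteDimensional k ℓ] (m : ℕ) :
    ((𝓞 ℓ)ˣ ⧸ (powMonoidHom m : (𝓞 ℓ)ˣ →* (𝓞 ℓ)ˣ).range) →*
      ((𝓞 k)ˣ ⧸ (powMonoidHom m : (𝓞 k)ˣ →* (𝓞 k)ˣ).range) :=
  QuotientGroup.map _ _ (Units.map (RingOfIntegers.norm k))
    (by
      rintro y ⟨x, rfl⟩
      exact ⟨Units.map ((RingOfIntegers.norm k : 𝓞 ℓ →* 𝓞 k)) x,
        by simp [powMonoidHom_apply, map_pow]⟩)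

/-- If `φ` is an embedding of a quadratic extension of `k` which is not real but whose restriction
to `k` is real, then the relative norm of `x` is sent to `‖φ x‖ ^ 2`. -/
theorem complexEmbedding_norm_eq_sq_norm {k ℓ : Type*} [Field k] [NumberField k] [Field ℓ]
    [NumberField ℓ] [Algebra k ℓ] [FiniteDimensional k ℓ] (hdeg : Module.finrank k ℓ = 2)
    (φ : ℓ →+* ℂ) (hφ : ¬ ComplexEmbedding.IsReal φ)
    (hk : ComplexEmbedding.IsReal (φ.comp (algebraMap k ℓ))) (x : ℓ) :
    φ (algebraMap k ℓ (Algebra.norm k x)) = (‖φ x‖ : ℂ) ^ 2 := by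
  classical
  let : Algebra k ℂ := (φ.comp (algebraMap k ℓ)).toAlgebra
  let f : ℓ →ₐ[k] ℂ := { φ with commutes' := fun _ => rfl }
  let g : ℓ →ₐ[k] ℂ :=
    { ComplexEmbedding.conjugate φ with commutes' := fun r => RingHom.congr_fun hk r }
  have hfg : f ≠ g := fun h => hφ (RingHom.ext fun y => (DFunLike.congr_fun h y).symm)
  have huniv : (Finset.univ : Finset (ℓ →ₐ[k] ℂ)) = {f, g} := by
    refine (Finset.eq_of_subset_of_card_le (Finset.subset_univ _) ?_).symm
    rw [Finset.card_univ, AlgHom.card, hdeg, Finset.card_pair hfg]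
  have h := Algebra.norm_eq_prod_embeddings k ℂ x
  rw [huniv, Finset.prod_pair hfg] at h
  exact h.trans (Complex.mul_conj' (φ x))

/-- In a finite commutative group, the subgroup of `n`-th powers has index equal to the number of
elements killed by `n`. -/
theorem index_range_powMonoidHom_eq_card_ker (G : Type*) [CommGroup G] [Finite G] (n : ℕ) :
    (powMonoidHom n : G →* G).range.index = Nat.card (powMonoidHom n : G →* G).ker := by
  have h₁ := (powMonoidHom n : G →* G).range.index_mul_card
  have h₂ := (powMonoidHom n : G →* G).ker.index_mul_card
  rw [Subgroup.index_ker, ← h₁, mul_comm] at h₂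
  exact (Nat.eq_of_mul_eq_mul_right Nat.card_pos h₂).symm

/-- The number of `n`-torsion elements in the torsion units is the number of `n`-th roots of
unity in the field. -/
theorem card_ker_powMonoidHom_torsion (K : Type*) [Field K] [NumberField K] {n : ℕ} (hn : n ≠ 0) :
    Nat.card (powMonoidHom n : Units.torsion K →* Units.torsion K).ker =
      Nat.card {x : K // x ^ n = 1} := by
  refine Nat.card_congr (Equiv.ofBijective
    (fun u => ⟨(((u : Units.torsion K) : (𝓞 K)ˣ) : K), ?_⟩) ⟨?_, ?_⟩)
  · have h := congrArg (fun v : Units.torsion K => (((v : (𝓞 K)ˣ) : 𝓞 K) : K)) u.2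
    simpa using h
  · intro u v h
    have h : (((u : Units.torsion K) : (𝓞 K)ˣ) : K) = ((v : Units.torsion K) : (𝓞 K)ˣ) :=
      Subtype.mk.inj h
    exact Subtype.ext (Subtype.ext (Units.coe_injective K h))
  · rintro ⟨x, hx⟩
    have hint : IsIntegral ℤ x := IsIntegral.of_pow (Nat.pos_of_ne_zero hn) (hx ▸ isIntegral_one)
    have hy : (⟨x, hint⟩ : 𝓞 K) ^ n = 1 := Subtype.ext hx
    have hu : Units.ofPowEqOne _ n hy hn ^ n = 1 := Units.pow_ofPowEqOne hy hn
    have ht : Units.ofPowEqOne _ n hy hn ∈ Units.torsion K :=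
      isOfFinOrder_iff_pow_eq_one.mpr ⟨n, Nat.pos_of_ne_zero hn, hu⟩
    exact ⟨⟨⟨_, ht⟩, Subtype.ext hu⟩, rfl⟩

/-- For `p` prime, a field contains `1` or `p` elements with `x ^ p = 1`, if finitely many. -/
theorem card_pow_prime_eq_one (K : Type*) [Field K] {p : ℕ} (hp : p.Prime) :
    Nat.card {x : K // x ^ p = 1} = 1 ∨ Nat.card {x : K // x ^ p = 1} = p := by
  have : NeZero p := ⟨hp.ne_zero⟩
  have e : Nat.card (rootsOfUnity p K) = Nat.card {x : K // x ^ p = 1} := by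
    rw [Nat.card_congr (rootsOfUnityEquivNthRoots K p)]
    exact Nat.card_congr (Equiv.subtypeEquivRight fun x => Polynomial.mem_nthRoots hp.pos)
  rw [← e, ← Nat.dvd_prime hp, ← IsCyclic.exponent_eq_card]
  exact Monoid.exponent_dvd_of_forall_pow_eq_one fun g => Subtype.ext g.2

/-- **§6.2 of the paper.** For a totally complex quadratic extension `ℓ` of a totally real
number field `k`, the norm-induced map `U_ℓ/U_ℓ³ → U_k/U_k³` is surjective and its kernel has
order equal to the number of cube roots of unity in `ℓ` (which is `1` or `3`). -/
theorem norm_unit_cube_quotient (k ℓ : Type*) [Field k] [NumberField k] [Field ℓ]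
    [NumberField ℓ] [Algebra k ℓ] [FiniteDimensional k ℓ]
    (hk : ∀ φ : k →+* ℂ, NumberField.ComplexEmbedding.IsReal φ)
    (hℓ : ∀ φ : ℓ →+* ℂ, ¬ NumberField.ComplexEmbedding.IsReal φ)
    (hdeg : Module.finrank k ℓ = 2) :
    Function.Surjective (normUnitQuotMap k ℓ 3) ∧
    Nat.card (normUnitQuotMap k ℓ 3).ker = Nat.card {x : ℓ // x ^ 3 = 1} ∧
    (Nat.card {x : ℓ // x ^ 3 = 1} = 1 ∨ Nat.card {x : ℓ // x ^ 3 = 1} = 3) := by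
  have hnorm (φ : ℓ →+* ℂ) (x : ℓ) :
      φ (algebraMap k ℓ (Algebra.norm k x)) = (‖φ x‖ : ℂ) ^ 2 :=
    complexEmbedding_norm_eq_sq_norm hdeg φ (hℓ φ) (hk _) x
  let N : (𝓞 ℓ)ˣ →* (𝓞 k)ˣ := Units.map (RingOfIntegers.norm k)
  let ι : (𝓞 k)ˣ →* (𝓞 ℓ)ˣ := Units.map (algebraMap (𝓞 k) (𝓞 ℓ)).toMonoidHom
  have hNι (v : (𝓞 k)ˣ) : N (ι v) = v ^ 2 := by
    apply Units.coe_injective k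
    have h := Algebra.norm_algebraMap (S := ℓ) (v : k)
    rw [hdeg] at h
    exact h.trans (Units.coe_pow v 2).symm
  have hNu (φ : ℓ →+* ℂ) (u : (𝓞 ℓ)ˣ) : φ (ι (N u) : ℓ) = (‖φ u‖ : ℂ) ^ 2 := hnorm φ u
  have hιinj : Function.Injective ι := by
    intro a b h
    apply Units.coe_injective k
    apply (algebraMap k ℓ).injective
    exact congrArg (fun v : (𝓞 ℓ)ˣ => (v : ℓ)) h
  have hNtors (u : (𝓞 ℓ)ˣ) (hu : u ∈ Units.torsion ℓ) : N u = 1 := by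
    apply hιinj
    apply Units.coe_injective ℓ
    let φ : ℓ →+* ℂ := Classical.arbitrary _
    apply φ.injective
    have h1 : ‖φ u‖ = 1 := (Units.mem_torsion ℓ).mp hu (InfinitePlace.mk φ)
    rw [hNu φ u, h1]
    simp
  have hquot (u : (𝓞 ℓ)ˣ) : u ^ 2 * (ι (N u))⁻¹ ∈ Units.torsion ℓ := by
    rw [Units.mem_torsion]
    intro w
    have h0 : ‖w.embedding u‖ ≠ 0 := by simp
    rw [← InfinitePlace.norm_embedding_eq]
    have h := hNu w.embedding u
    have h' : ‖w.embedding (ι (N u) : ℓ)‖ = ‖w.embedding u‖ ^ 2 := by rw [h]; simp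
    have hinv : (((ι (N u))⁻¹ : (𝓞 ℓ)ˣ) : ℓ) = (ι (N u) : ℓ)⁻¹ := by
      simp
    rw [Units.coe_mul, Units.coe_pow, hinv, map_mul, map_pow, map_inv₀, norm_mul, norm_inv, norm_pow, h']
    exact mul_inv_cancel₀ (pow_ne_zero 2 h0)
  refine ⟨?_, ?_, card_pow_prime_eq_one ℓ Nat.prime_three⟩
  · intro y
    obtain ⟨v, rfl⟩ := QuotientGroup.mk_surjective y
    refine ⟨QuotientGroup.mk (ι v⁻¹), ?_⟩
    refine QuotientGroup.eq.mpr ⟨v, ?_⟩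
    change v ^ 3 = (N (ι v⁻¹))⁻¹ * v
    rw [hNι]
    group
  · let q : Units.torsion ℓ →* _ :=
      (QuotientGroup.mk' (powMonoidHom 3 : (𝓞 ℓ)ˣ →* (𝓞 ℓ)ˣ).range).comp
        (Units.torsion ℓ).subtype
    have hrange : (normUnitQuotMap k ℓ 3).ker = q.range := by
      ext y
      obtain ⟨u, rfl⟩ := QuotientGroup.mk_surjective y
      constructor
      · intro hu
        obtain ⟨v, hv⟩ := (QuotientGroup.eq_one_iff (N u)).mp hu
        have hv : v ^ 3 = N u := hv
        refine ⟨⟨_, hquot u⟩⁻¹, QuotientGroup.eq.mpr ⟨u * (ι v)⁻¹, ?_⟩⟩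
        change (u * (ι v)⁻¹) ^ 3 = ((u ^ 2 * (ι (N u))⁻¹)⁻¹)⁻¹ * u
        rw [← hv, map_pow, inv_inv, mul_pow, inv_pow, pow_succ u 2]
        exact mul_right_comm _ _ _
      · rintro ⟨t, ht⟩
        rw [← ht]
        change (QuotientGroup.mk (N (t : (𝓞 ℓ)ˣ)) : (𝓞 k)ˣ ⧸ _) = 1
        rw [hNtors _ t.2]
        rfl
    have hker : q.ker = (powMonoidHom 3 : Units.torsion ℓ →* Units.torsion ℓ).range := by
      ext t
      constructor
      · intro h
        obtain ⟨u, hu⟩ := (QuotientGroup.eq_one_iff (t : (𝓞 ℓ)ˣ)).mp h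
        have hu : u ^ 3 = t := hu
        have hut : u ∈ Units.torsion ℓ :=
          IsOfFinOrder.of_pow (n := 3) (hu ▸ t.2) (by norm_num)
        exact ⟨⟨u, hut⟩, Subtype.ext hu⟩
      · rintro ⟨s, rfl⟩
        exact (QuotientGroup.eq_one_iff _).mpr ⟨s, rfl⟩
    rw [hrange, ← Subgroup.index_ker, hker, index_range_powMonoidHom_eq_card_ker,
      card_ker_powMonoidHom_torsion ℓ three_ne_zero]
end

section
/- Let k be a totally real number field of degree d, let ℓ be a totally complex quadratic extension of k, and let n be an odd positive integer. Then the kernel of the homomorphism U_ℓ/U_ℓ^{n+1} → U_k/U_k^{n+1} induced by the norm map N_{ℓ/k} has order at most #μ_{n+1}(ℓ) · 2^{d−1}, where #μ_{n+1}(ℓ) is the number of (n+1)-th roots of unity contained in ℓ. -/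
open NumberField

/-- For a quadratic extension `ℓ/k` with `k` totally real and `ℓ` totally complex, the relative
norm computes the squared absolute value under every complex embedding. -/
theorem embedding_norm_eq_norm_sq {k ℓ : Type*} [Field k] [NumberField k] [Field ℓ]
    [NumberField ℓ] [Algebra k ℓ] [FiniteDimensional k ℓ]
    (hk : ∀ φ : k →+* ℂ, NumberField.ComplexEmbedding.IsReal φ)
    (hℓ : ∀ φ : ℓ →+* ℂ, ¬ NumberField.ComplexEmbedding.IsReal φ)
    (hdeg : Module.finrank k ℓ = 2) (φ : ℓ →+* ℂ) (x : ℓ) :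
    φ (algebraMap k ℓ (Algebra.norm k x)) = (‖φ x‖ : ℂ) ^ 2 := by
  classical
  let : Algebra k ℂ := (φ.comp (algebraMap k ℓ)).toAlgebra
  let f : ℓ →ₐ[k] ℂ := { φ with commutes' := fun _ => rfl }
  let g : ℓ →ₐ[k] ℂ :=
    { NumberField.ComplexEmbedding.conjugate φ with
      commutes' := fun r => RingHom.congr_fun (hk (φ.comp (algebraMap k ℓ))) r }
  have hfg : f ≠ g := fun h => hℓ φ (RingHom.ext fun y => (DFunLike.congr_fun h y).symm)
  have huniv : ({f, g} : Finset (ℓ →ₐ[k] ℂ)) = Finset.univ := by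
    apply Finset.eq_univ_of_card
    rw [Finset.card_pair hfg, AlgHom.card, hdeg]
  have h := Algebra.norm_eq_prod_embeddings k ℂ x
  rw [← huniv, Finset.prod_pair hfg] at h
  exact h.trans (Complex.mul_conj' (φ x))

open NumberField.Units in
/-- A unit of relative norm one is a root of unity. -/
theorem mem_torsion_of_norm_eq_one {k ℓ : Type*} [Field k] [NumberField k] [Field ℓ]
    [NumberField ℓ] [Algebra k ℓ] [FiniteDimensional k ℓ]
    (hk : ∀ φ : k →+* ℂ, NumberField.ComplexEmbedding.IsReal φ)
    (hℓ : ∀ φ : ℓ →+* ℂ, ¬ NumberField.ComplexEmbedding.IsReal φ)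
    (hdeg : Module.finrank k ℓ = 2) {u : (𝓞 ℓ)ˣ}
    (hu : Units.map (RingOfIntegers.norm k) u = 1) : u ∈ torsion ℓ := by
  rw [mem_torsion]
  intro w
  have hnorm : Algebra.norm k ((u : 𝓞 ℓ) : ℓ) = 1 :=
    congrArg (fun z : (𝓞 k)ˣ => ((z : 𝓞 k) : k)) hu
  have h := embedding_norm_eq_norm_sq hk hℓ hdeg w.embedding ((u : 𝓞 ℓ) : ℓ)
  rw [hnorm, map_one, map_one] at h
  rw [← InfinitePlace.norm_embedding_eq]
  exact (pow_eq_one_iff_of_nonneg (norm_nonneg _) two_ne_zero).mp (by exact_mod_cast h.symm)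

open NumberField.Units in
/-- The rank of the unit group of a totally real field is one less than its degree. -/
theorem rank_eq_finrank_sub_one {k : Type*} [Field k] [NumberField k]
    (hk : ∀ φ : k →+* ℂ, NumberField.ComplexEmbedding.IsReal φ) :
    rank k = Module.finrank ℚ k - 1 := by
  have : IsTotallyReal k := ⟨fun v => InfinitePlace.isReal_iff.mpr (hk _)⟩
  rw [rank, InfinitePlace.card_eq_nrRealPlaces_add_nrComplexPlaces,
    nrComplexPlaces_eq_zero_iff.mpr this, add_zero, IsTotallyReal.finrank]

open NumberField.Units in
/-- Modulo `m`-th powers, the roots of unity of `K` have as many classes as `K` has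
`m`-th roots of unity, at most. -/
theorem card_torsion_quotient_pow_le (K : Type*) [Field K] [NumberField K] {m : ℕ} (hm : m ≠ 0) :
    Nat.card (torsion K ⧸ (powMonoidHom m : torsion K →* torsion K).range) ≤
      Nat.card {x : K // x ^ m = 1} := by
  classical
  have hfin : Finite {x : K // x ^ m = 1} :=
    (Set.Finite.subset (Polynomial.nthRoots m (1 : K)).toFinset.finite_toSet fun x hx => by
      simpa [Polynomial.mem_nthRoots (Nat.pos_of_ne_zero hm)] using Set.mem_ofPred.mp hx :
      {x : K | x ^ m = 1}.Finite).to_subtype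
  rw [← Subgroup.index_eq_card, Subgroup.index_range]
  refine Nat.card_le_card_of_injective
    (fun z : (powMonoidHom m : torsion K →* torsion K).ker =>
      (⟨(((z : torsion K) : (𝓞 K)ˣ) : 𝓞 K), ?_⟩ : {x : K // x ^ m = 1})) ?_
  · have h : (z : torsion K) ^ m = 1 := z.2
    exact congrArg (fun t : torsion K => (((t : (𝓞 K)ˣ) : 𝓞 K) : K)) h
  · intro a b hab
    exact Subtype.ext (Subtype.ext (Units.ext (RingOfIntegers.ext (Subtype.mk.inj hab))))

open NumberField.Units in
/-- Every unit is, up to a root of unity and a square, a product of distinct fundamental units. -/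
theorem exists_eq_torsion_mul_prod_mul_sq (K : Type*) [Field K] [NumberField K] (v : (𝓞 K)ˣ) :
    ∃ ζ ∈ torsion K, ∃ e : Fin (rank K) → Fin 2, ∃ y : (𝓞 K)ˣ,
      v = ζ * (∏ i, fundSystem K i ^ (e i : ℕ)) * y ^ 2 := by
  obtain ⟨⟨ζ, a⟩, hv, -⟩ := exist_unique_eq_mul_prod K v
  refine ⟨ζ, ζ.2, fun i => ⟨(a i % 2).toNat, by omega⟩, ∏ i, fundSystem K i ^ (a i / 2), ?_⟩
  rw [hv, mul_assoc, ← Finset.prod_pow, ← Finset.prod_mul_distrib]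
  congr 1
  refine Finset.prod_congr rfl fun i _ => ?_
  rw [← zpow_natCast, ← zpow_natCast, ← zpow_mul, ← zpow_add]
  congr 1
  push_cast
  omega

open NumberField.Units in
/-- If the norm of `u` is a `2s`-th power of a unit of `k`, then `u` is, up to a root of unity,
the `s`-th power of a unit of `k`. -/
theorem exists_eq_torsion_mul_map_pow {k ℓ : Type*} [Field k] [NumberField k] [Field ℓ]
    [NumberField ℓ] [Algebra k ℓ] [FiniteDimensional k ℓ]
    (hk : ∀ φ : k →+* ℂ, NumberField.ComplexEmbedding.IsReal φ)
    (hℓ : ∀ φ : ℓ →+* ℂ, ¬ NumberField.ComplexEmbedding.IsReal φ)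
    (hdeg : Module.finrank k ℓ = 2) {s : ℕ} {u : (𝓞 ℓ)ˣ} {v : (𝓞 k)ˣ}
    (hu : Units.map (RingOfIntegers.norm k) u = v ^ (2 * s)) :
    ∃ ζ ∈ torsion ℓ, u = ζ * Units.map (algebraMap (𝓞 k) (𝓞 ℓ)).toMonoidHom v ^ s := by
  refine ⟨u * (Units.map (algebraMap (𝓞 k) (𝓞 ℓ)).toMonoidHom v ^ s)⁻¹, ?_, by group⟩
  refine mem_torsion_of_norm_eq_one hk hℓ hdeg ?_
  have hv : Units.map (RingOfIntegers.norm k)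
      (Units.map (algebraMap (𝓞 k) (𝓞 ℓ)).toMonoidHom v) = v ^ 2 := by
    refine Units.ext (RingOfIntegers.ext ?_)
    have := Algebra.norm_algebraMap (S := ℓ) ((v : 𝓞 k) : k)
    rw [hdeg] at this
    exact this
  rw [map_mul, map_inv, map_pow, hu, hv, pow_mul, mul_inv_cancel]

/-- **§8.1 of the paper.** For a totally complex quadratic extension `ℓ` of a totally real
number field `k` of degree `d` and an odd positive integer `n`, the kernel of the norm-induced
map `U_ℓ/U_ℓ^{n+1} → U_k/U_k^{n+1}` has order at most `#μ_{n+1}(ℓ) · 2^{d−1}`. -/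
theorem card_ker_norm_unit_quotient_le (k ℓ : Type*) [Field k] [NumberField k] [Field ℓ]
    [NumberField ℓ] [Algebra k ℓ] [FiniteDimensional k ℓ]
    (hk : ∀ φ : k →+* ℂ, NumberField.ComplexEmbedding.IsReal φ)
    (hℓ : ∀ φ : ℓ →+* ℂ, ¬ NumberField.ComplexEmbedding.IsReal φ)
    (hdeg : Module.finrank k ℓ = 2)
    (n : ℕ) (hn : Odd n) (hnpos : 0 < n) :
    Nat.card (normUnitQuotMap k ℓ (n + 1)).ker ≤
      Nat.card {x : ℓ // x ^ (n + 1) = 1} * 2 ^ (Module.finrank ℚ k - 1) := by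
  classical
  obtain ⟨t, rfl⟩ := hn
  obtain ⟨s, hs⟩ : ∃ s, 2 * t + 1 + 1 = 2 * s := ⟨t + 1, by ring⟩
  generalize hm : 2 * t + 1 + 1 = m at hs ⊢
  have hm0 : m ≠ 0 := by omega
  let j : (𝓞 k)ˣ →* (𝓞 ℓ)ˣ := Units.map (algebraMap (𝓞 k) (𝓞 ℓ)).toMonoidHom
  let P := (powMonoidHom m : NumberField.Units.torsion ℓ →* NumberField.Units.torsion ℓ).range
  let F : (NumberField.Units.torsion ℓ ⧸ P) × (Fin (NumberField.Units.rank k) → Fin 2) →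
      (𝓞 ℓ)ˣ ⧸ (powMonoidHom m : (𝓞 ℓ)ˣ →* (𝓞 ℓ)ˣ).range :=
    fun p => QuotientGroup.mk
      ((p.1.out : (𝓞 ℓ)ˣ) * j (∏ i, NumberField.Units.fundSystem k i ^ (p.2 i : ℕ)) ^ s)
  have hF : ((normUnitQuotMap k ℓ m).ker : Set _) ⊆ Set.range F := by
    intro x hx
    obtain ⟨u, rfl⟩ := QuotientGroup.mk_surjective x
    obtain ⟨v, hv⟩ := (QuotientGroup.eq_one_iff _).mp (MonoidHom.mem_ker.mp hx)
    obtain ⟨ζ, hζ, hu⟩ := exists_eq_torsion_mul_map_pow hk hℓ hdeg (s := s) (u := u) (v := v)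
      (by rw [← hs]; exact hv.symm)
    obtain ⟨ξ, hξ, e, y, hvy⟩ := exists_eq_torsion_mul_prod_mul_sq k v
    have hη : ζ * j ξ ^ s ∈ NumberField.Units.torsion ℓ :=
      mul_mem hζ (pow_mem (MonoidHom.isOfFinOrder j hξ) s)
    obtain ⟨⟨_, w, rfl⟩, hw⟩ :=
      QuotientGroup.mk_out_eq_mul P (⟨ζ * j ξ ^ s, hη⟩ : NumberField.Units.torsion ℓ)
    refine ⟨(QuotientGroup.mk ⟨ζ * j ξ ^ s, hη⟩, e), ?_⟩
    refine QuotientGroup.eq.mpr ⟨(w : (𝓞 ℓ)ˣ)⁻¹ * j y, ?_⟩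
    have hw' := congrArg (Subtype.val : NumberField.Units.torsion ℓ → (𝓞 ℓ)ˣ) hw
    change _ = ζ * j ξ ^ s * (w : (𝓞 ℓ)ˣ) ^ m at hw'
    change u = ζ * j v ^ s at hu
    rw [eq_inv_mul_iff_mul_eq, hw', hu, hvy, powMonoidHom_apply]
    simp only [map_mul, mul_pow, inv_pow, map_pow j y, ← pow_mul, ← hs]
    have rearrange (a b c d x : (𝓞 ℓ)ˣ) : a * b * x * c * (x⁻¹ * d) = a * (b * c * d) := by
      calc _ = x * x⁻¹ * (a * (b * c * d)) := by ac_rfl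
        _ = _ := by rw [mul_inv_cancel, one_mul]
    exact rearrange _ _ _ _ _
  calc Nat.card (normUnitQuotMap k ℓ m).ker
      ≤ Nat.card (Set.range F) := Nat.card_mono (Set.finite_range F) hF
    _ ≤ Nat.card ((NumberField.Units.torsion ℓ ⧸ P) × (Fin (NumberField.Units.rank k) → Fin 2)) :=
        Nat.card_le_card_of_surjective _ Set.rangeFactorization_surjective
    _ = Nat.card (NumberField.Units.torsion ℓ ⧸ P) * 2 ^ (Module.finrank ℚ k - 1) := by
        simp [Nat.card_prod, rank_eq_finrank_sub_one hk]
    _ ≤ _ := Nat.mul_le_mul_right _ (card_torsion_quotient_pow_le ℓ hm0)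
end

section
/- Let χ be the unique nontrivial Dirichlet character modulo 3. Its analytically continued Dirichlet L-function satisfies L(χ,−2) = −2/9, L(χ,−4) = 2/3, L(χ,−6) = −14/3, L(χ,−8) = 1618/27, L(χ,−10) = −3694/3, and L(χ,−12) = 111202/3. -/
open DirichletCharacter

theorem bernoulli'_five : bernoulli' 5 = 0 :=
  bernoulli'_eq_zero_of_odd (by decide) (by norm_num)

theorem bernoulli'_seven : bernoulli' 7 = 0 :=
  bernoulli'_eq_zero_of_odd (by decide) (by norm_num)

theorem bernoulli'_nine : bernoulli' 9 = 0 :=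
  bernoulli'_eq_zero_of_odd (by decide) (by norm_num)

theorem bernoulli'_eleven : bernoulli' 11 = 0 :=
  bernoulli'_eq_zero_of_odd (by decide) (by norm_num)

theorem bernoulli'_six : bernoulli' 6 = 1 / 42 := by
  rw [bernoulli'_def]
  norm_num [Finset.sum_range_succ, Nat.choose, bernoulli'_five]

theorem bernoulli'_eight : bernoulli' 8 = -1 / 30 := by
  rw [bernoulli'_def]
  norm_num [Finset.sum_range_succ, Nat.choose, bernoulli'_six, bernoulli'_five, bernoulli'_seven]

theorem bernoulli'_ten : bernoulli' 10 = 5 / 66 := by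
  rw [bernoulli'_def]
  norm_num [Finset.sum_range_succ, Nat.choose, bernoulli'_six, bernoulli'_eight, bernoulli'_five,
    bernoulli'_seven, bernoulli'_nine]

theorem bernoulli'_twelve : bernoulli' 12 = -691 / 2730 := by
  rw [bernoulli'_def]
  norm_num [Finset.sum_range_succ, Nat.choose, bernoulli'_six, bernoulli'_eight, bernoulli'_ten,
    bernoulli'_five, bernoulli'_seven, bernoulli'_nine, bernoulli'_eleven]

theorem DirichletCharacter.apply_two_of_ne_one {χ : DirichletCharacter ℂ 3} (hχ : χ ≠ 1) :
    χ 2 = -1 := by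
  have hsq : χ 2 * χ 2 = 1 := by
    rw [← map_mul, show (2 * 2 : ZMod 3) = 1 by decide, map_one]
  refine (mul_self_eq_one_iff.mp hsq).resolve_left fun h ↦ hχ ?_
  refine MulChar.ext fun u ↦ ?_
  have hu : (u : ZMod 3) = 1 ∨ (u : ZMod 3) = 2 := by revert u; decide
  rw [MulChar.one_apply_coe]
  rcases hu with hu | hu
  · rw [hu, map_one]
  · rw [hu, h]

theorem DirichletCharacter.LFunction_mod_three_neg_nat {χ : DirichletCharacter ℂ 3}
    (hχ : χ ≠ 1) {k : ℕ} (hk : k ≠ 0) :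
    LFunction χ (-k) = (-3 ^ k / (k + 1) * (
      (Polynomial.bernoulli (k + 1)).eval (1 / 3) -
        (Polynomial.bernoulli (k + 1)).eval (2 / 3)) : ℚ) := by
  have key (q : ℚ) (hq : (q : ℝ) ∈ Set.Icc (0 : ℝ) 1) :
      HurwitzZeta.hurwitzZeta ((q : ℝ) : UnitAddCircle) (-k) =
        (-1 / (k + 1) * (Polynomial.bernoulli (k + 1)).eval q : ℚ) := by
    rw [HurwitzZeta.hurwitzZeta_neg_nat hk hq]
    have := Polynomial.eval_map_apply (f := algebraMap ℚ ℂ) (p := Polynomial.bernoulli (k + 1)) q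
    rw [eq_ratCast, eq_ratCast] at this
    rw [Complex.ofReal_ratCast, this]
    push_cast
    rfl
  have hsum (f : ZMod 3 → ℂ) : ∑ j, f j = f 0 + f 1 + f 2 := Fin.sum_univ_three f
  have h1 : ZMod.toAddCircle (1 : ZMod 3) = (((1 / 3 : ℚ) : ℝ) : UnitAddCircle) := by
    simp [ZMod.toAddCircle_apply, ZMod.val_one]
  have h2 : ZMod.toAddCircle (2 : ZMod 3) = (((2 / 3 : ℚ) : ℝ) : UnitAddCircle) := by
    rw [ZMod.toAddCircle_apply, show (2 : ZMod 3).val = 2 by rfl]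
    simp
  rw [LFunction, ZMod.LFunction, hsum, h1, h2, key _ (by norm_num), key _ (by norm_num),
    χ.map_zero, map_one, apply_two_of_ne_one hχ, neg_neg, Complex.cpow_natCast]
  push_cast
  ring

/-- **§9.4 of the paper, row `a = 3`.** Values of the Dirichlet `L`-function of the unique
nontrivial Dirichlet character modulo `3` at negative even integers. -/
theorem LFunction_mod_three_values (χ : DirichletCharacter ℂ 3) (hχ : χ ≠ 1) :
    LFunction χ (-2) = -2 / 9 ∧
    LFunction χ (-4) = 2 / 3 ∧
    LFunction χ (-6) = -14 / 3 ∧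
    LFunction χ (-8) = 1618 / 27 ∧
    LFunction χ (-10) = -3694 / 3 ∧
    LFunction χ (-12) = 111202 / 3 := by
  have value (k : ℕ) (q : ℚ) (hk : k ≠ 0) (hq : -3 ^ k / (k + 1) * (
      (Polynomial.bernoulli (k + 1)).eval (1 / 3) -
        (Polynomial.bernoulli (k + 1)).eval (2 / 3)) = q) : LFunction χ (-k) = q := by
    rw [LFunction_mod_three_neg_nat hχ hk, hq]
  refine ⟨?_, ?_, ?_, ?_, ?_, ?_⟩
  · simpa using value 2 (-2 / 9) (by norm_num) (by
      norm_num [Polynomial.bernoulli, Finset.sum_range_succ, Nat.choose, bernoulli])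
  · simpa using value 4 (2 / 3) (by norm_num) (by
      norm_num [Polynomial.bernoulli, Finset.sum_range_succ, Nat.choose, bernoulli])
  · simpa using value 6 (-14 / 3) (by norm_num) (by
      norm_num [Polynomial.bernoulli, Finset.sum_range_succ, Nat.choose, bernoulli,
        bernoulli'_five, bernoulli'_six])
  · simpa using value 8 (1618 / 27) (by norm_num) (by
      norm_num [Polynomial.bernoulli, Finset.sum_range_succ, Nat.choose, bernoulli,
        bernoulli'_five, bernoulli'_six, bernoulli'_seven, bernoulli'_eight])
  · simpa using value 10 (-3694 / 3) (by norm_num) (by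
      norm_num [Polynomial.bernoulli, Finset.sum_range_succ, Nat.choose, bernoulli,
        bernoulli'_five, bernoulli'_six, bernoulli'_seven, bernoulli'_eight,
        bernoulli'_nine, bernoulli'_ten])
  · simpa using value 12 (111202 / 3) (by norm_num) (by
      norm_num [Polynomial.bernoulli, Finset.sum_range_succ, Nat.choose, bernoulli,
        bernoulli'_five, bernoulli'_six, bernoulli'_seven, bernoulli'_eight,
        bernoulli'_nine, bernoulli'_ten, bernoulli'_eleven, bernoulli'_twelve])
end

section
/- Let χ be the unique quadratic (order two) Dirichlet character modulo 11, i.e., the Legendre symbol modulo 11. Its analytically continued Dirichlet L-function satisfies L(χ,−2) = −6, L(χ,−4) = 2550/11, and L(χ,−6) = −21726. -/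
open DirichletCharacter

/-- Values of congruence `L`-functions at negative integers, in terms of Bernoulli polynomials. -/
theorem ZMod.LFunction_neg_nat {N : ℕ} [NeZero N] (Φ : ZMod N → ℂ) {k : ℕ} (hk : k ≠ 0) :
    ZMod.LFunction Φ (-k) = -(N : ℂ) ^ k / (k + 1) *
      ∑ j : ZMod N, Φ j * (((Polynomial.bernoulli (k + 1)).eval (j.val / N : ℚ) : ℚ) : ℂ) := by
  rw [ZMod.LFunction, neg_neg, Complex.cpow_natCast, Finset.mul_sum, Finset.mul_sum]
  refine Finset.sum_congr rfl fun j _ ↦ ?_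
  have hx : (j.val / N : ℝ) ∈ Set.Icc (0 : ℝ) 1 := ⟨by positivity,
    (div_le_one (Nat.cast_pos.mpr (NeZero.pos N))).mpr (Nat.cast_le.mpr (ZMod.val_lt j).le)⟩
  have hcast : (((j.val / N : ℝ) : ℝ) : ℂ) = algebraMap ℚ ℂ (j.val / N : ℚ) := by
    simp only [eq_ratCast, Complex.ofReal_div, Complex.ofReal_natCast, Rat.cast_div,
      Rat.cast_natCast]
  rw [ZMod.toAddCircle_apply, HurwitzZeta.hurwitzZeta_neg_nat hk hx, hcast,
    Polynomial.eval_map_algebraMap, Polynomial.aeval_algebraMap_apply]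
  simp only [Polynomial.coe_aeval_eq_eval, eq_ratCast]
  ring

/-- A nontrivial quadratic Dirichlet character modulo `11` sends the primitive root `2` to `-1`. -/
theorem DirichletCharacter.apply_two_of_sq_eq_one_mod_eleven {χ : DirichletCharacter ℂ 11}
    (hχ : χ ≠ 1) (hχ2 : χ ^ 2 = 1) : χ 2 = -1 := by
  have hu : IsUnit (2 : ZMod 11) := ⟨⟨2, 6, by decide, by decide⟩, rfl⟩
  have hsq : χ 2 ^ 2 = 1 := by
    rw [← MulChar.pow_apply' χ two_ne_zero, hχ2, MulChar.one_apply hu]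
  refine (eq_or_eq_neg_of_sq_eq_sq _ _ (hsq.trans (one_pow 2).symm)).resolve_left fun h ↦
    hχ (MulChar.ext fun a ↦ ?_)
  obtain ⟨m, hm⟩ : ∃ m : Fin 10, (a : ZMod 11) = 2 ^ (m : ℕ) := by
    revert a; decide
  rw [MulChar.one_apply_coe, hm, map_pow, h, one_pow]

/-- The values of the quadratic character modulo `11`. -/
theorem DirichletCharacter.apply_of_sq_eq_one_mod_eleven {χ : DirichletCharacter ℂ 11}
    (hχ : χ ≠ 1) (hχ2 : χ ^ 2 = 1) (j : ZMod 11) :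
    χ j = ((![0, 1, -1, 1, 1, 1, -1, -1, -1, 1, -1] : Fin 11 → ℚ) j : ℂ) := by
  have h2 := apply_two_of_sq_eq_one_mod_eleven hχ hχ2
  have hpow (m : ℕ) : χ (2 ^ m) = (-1) ^ m := by rw [map_pow, h2]
  have h0 : χ 0 = 0 := χ.map_nonunit (by simpa using (by decide : ¬ ∃ b : ZMod 11, 0 * b = 1))
  have h1 := hpow 0
  have h4 := hpow 2
  have h8 := hpow 3
  have h5 := hpow 4
  have h10 := hpow 5
  have h9 := hpow 6
  have h7 := hpow 7
  have h3 := hpow 8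
  have h6 := hpow 9
  rw [show (2 : ZMod 11) ^ 2 = 4 by decide] at h4
  rw [show (2 : ZMod 11) ^ 3 = 8 by decide] at h8
  rw [show (2 : ZMod 11) ^ 4 = 5 by decide] at h5
  rw [show (2 : ZMod 11) ^ 5 = 10 by decide] at h10
  rw [show (2 : ZMod 11) ^ 6 = 9 by decide] at h9
  rw [show (2 : ZMod 11) ^ 7 = 7 by decide] at h7
  rw [show (2 : ZMod 11) ^ 8 = 3 by decide] at h3
  rw [show (2 : ZMod 11) ^ 9 = 6 by decide] at h6
  change Fin 11 at j
  fin_cases j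
  · exact h0.trans (by simp)
  · exact h1.trans (by simp)
  · exact h2.trans (by simp)
  · exact h3.trans (by norm_num)
  · exact h4.trans (by simp)
  · exact h5.trans (by norm_num)
  · exact h6.trans (by norm_num)
  · exact h7.trans (by norm_num)
  · exact h8.trans (by norm_num)
  · exact h9.trans (by norm_num)
  · exact h10.trans (by norm_num)

/-- The `L`-function of the quadratic character modulo `11` at negative integers, as an explicit
rational number. -/
theorem DirichletCharacter.LFunction_neg_nat_mod_eleven {χ : DirichletCharacter ℂ 11}
    (hχ : χ ≠ 1) (hχ2 : χ ^ 2 = 1) {k : ℕ} (hk : k ≠ 0) :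
    LFunction χ (-k) = ((-11 ^ k / (k + 1) *
      ∑ j : Fin 11, (![0, 1, -1, 1, 1, 1, -1, -1, -1, 1, -1] : Fin 11 → ℚ) j *
        (Polynomial.bernoulli (k + 1)).eval ((j : ℕ) / 11 : ℚ) : ℚ) : ℂ) := by
  rw [LFunction, ZMod.LFunction_neg_nat _ hk]
  simp only [apply_of_sq_eq_one_mod_eleven hχ hχ2]
  push_cast
  rfl

theorem bernoulli_six : bernoulli 6 = 1 / 42 := by
  rw [bernoulli_eq_bernoulli'_of_ne_one (by decide), bernoulli'_def]
  norm_num [Finset.sum_range_succ, Nat.choose,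
    bernoulli'_eq_zero_of_odd (show Odd 5 by decide) (by norm_num)]

theorem bernoulli_four : bernoulli 4 = -1 / 30 := by
  rw [bernoulli_eq_bernoulli'_of_ne_one (by decide), bernoulli'_four]

/-- **§9.4 of the paper, row `a = 11`.** Values of the Dirichlet `L`-function of the unique
quadratic (order two) Dirichlet character modulo `11` at negative even integers. -/
theorem LFunction_mod_eleven_values (χ : DirichletCharacter ℂ 11)
    (hχ : χ ≠ 1) (hχ2 : χ ^ 2 = 1) :
    LFunction χ (-2) = -6 ∧
    LFunction χ (-4) = 2550 / 11 ∧
    LFunction χ (-6) = -21726 := by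
  have b3 : bernoulli 3 = 0 := bernoulli_eq_zero_of_odd (by decide) (by norm_num)
  have b5 : bernoulli 5 = 0 := bernoulli_eq_zero_of_odd (by decide) (by norm_num)
  have b7 : bernoulli 7 = 0 := bernoulli_eq_zero_of_odd (by decide) (by norm_num)
  have h2 := LFunction_neg_nat_mod_eleven hχ hχ2 (k := 2) two_ne_zero
  have h4 := LFunction_neg_nat_mod_eleven hχ hχ2 (k := 4) four_ne_zero
  have h6 := LFunction_neg_nat_mod_eleven hχ hχ2 (k := 6) (by norm_num)
  simp only [Nat.cast_ofNat] at h2 h4 h6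
  rw [h2, h4, h6]
  refine ⟨?_, ?_, ?_⟩ <;>
  · norm_num [Polynomial.bernoulli, Polynomial.eval_finsetSum, Polynomial.eval_monomial,
      Finset.sum_range_succ, Fin.sum_univ_succ, Nat.choose, b3, b5, b7, bernoulli_six,
      bernoulli_four]
end
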